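/- Let a, b, c be pairwise coprime integers, each at least 2, and let B be a nonnegative real number such that for every positive integer t the real part of P_t(a,b,c) is at most B. Then g(a,b,c) ≤ √( 2B·abc + (a² + b² + c²)/12 ) − (a + b + c)/2. -/

import Mathlib

open Complex Real Finset

/-- The "periodic part" `P_t(a,b,c)` of the counting function `N_t(a,b,c)`. -/
noncomputable def periodicPart (a b c : ℕ) (t : ℤ) : ℂ :=
  (1 / (4 * (a : ℂ))) * ∑ k ∈ Finset.Icc 1 (a - 1),
      Complex.exp (Real.pi * Complex.I * k / a * (2 * t + b + c)) /
        ((Real.sin (Real.pi * k * b / a) : ℂ) * (Real.sin (Real.pi * k * c / a) : ℂ)) +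
    (1 / (4 * (b : ℂ))) * ∑ k ∈ Finset.Icc 1 (b - 1),
      Complex.exp (Real.pi * Complex.I * k / b * (2 * t + a + c)) /
        ((Real.sin (Real.pi * k * a / b) : ℂ) * (Real.sin (Real.pi * k * c / b) : ℂ)) +
    (1 / (4 * (c : ℂ))) * ∑ k ∈ Finset.Icc 1 (c - 1),
      Complex.exp (Real.pi * Complex.I * k / c * (2 * t + a + b)) /
        ((Real.sin (Real.pi * k * a / c) : ℂ) * (Real.sin (Real.pi * k * b / c) : ℂ))

section Trigonometric

theorem cexp_two_pi_mul_div_eq_one_iff {a : ℕ} (ha : a ≠ 0) (t : ℤ) :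
    Complex.exp (2 * Real.pi * Complex.I * t / a) = 1 ↔ (a : ℤ) ∣ t := by
  have ha' : (a : ℂ) ≠ 0 := by exact_mod_cast ha
  have hpi : (Real.pi : ℂ) ≠ 0 := by exact_mod_cast Real.pi_ne_zero
  rw [Complex.exp_eq_one_iff]
  constructor
  · rintro ⟨n, hn⟩
    refine ⟨n, ?_⟩
    have h : (t : ℂ) = a * n := by
      have hI := Complex.I_ne_zero
      field_simp at hn
      linear_combination hn
    exact_mod_cast h
  · rintro ⟨n, rfl⟩
    refine ⟨n, ?_⟩
    push_cast
    field_simp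

/-- Orthogonality of the additive characters modulo `a`. -/
theorem sum_range_cexp_two_pi_mul_div {a : ℕ} (ha : a ≠ 0) (t : ℤ) :
    ∑ k ∈ Finset.range a, Complex.exp (2 * Real.pi * Complex.I * k * t / a) =
      if (a : ℤ) ∣ t then (a : ℂ) else 0 := by
  have hpow : ∀ k : ℕ, Complex.exp (2 * Real.pi * Complex.I * k * t / a) =
      Complex.exp (2 * Real.pi * Complex.I * t / a) ^ k := fun k => by
    rw [← Complex.exp_nat_mul]
    ring_nf
  simp_rw [hpow]
  split_ifs with h
  · rw [(cexp_two_pi_mul_div_eq_one_iff ha t).2 h]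
    simp
  · have h1 := mt (cexp_two_pi_mul_div_eq_one_iff ha t).1 h
    rw [geom_sum_eq h1, ← hpow, div_eq_zero_iff]
    left
    have ha' : (a : ℂ) ≠ 0 := by exact_mod_cast ha
    have h2 : 2 * Real.pi * Complex.I * a * t / a = t * (2 * Real.pi * Complex.I) := by
      field_simp
    rw [h2, Complex.exp_int_mul_two_pi_mul_I, sub_self]

theorem sin_pi_mul_div_ne_zero {a b k : ℕ} (hab : Nat.Coprime a b)
    (hk : k ∈ Finset.Icc 1 (a - 1)) : Real.sin (Real.pi * k * b / a) ≠ 0 := by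
  rw [Finset.mem_Icc] at hk
  intro h
  obtain ⟨n, hn⟩ := Real.sin_eq_zero_iff.1 h
  have ha : (a : ℝ) ≠ 0 := by
    have : a ≠ 0 := by omega
    exact_mod_cast this
  have h1 : (n : ℝ) * a = k * b := by
    field_simp at hn
    linear_combination hn
  have h2 : (a : ℤ) ∣ k * b := ⟨n, by rw [mul_comm (a : ℤ)]; exact_mod_cast h1.symm⟩
  have h3 : a ∣ k := hab.dvd_of_dvd_mul_right (by exact_mod_cast h2)
  have := Nat.le_of_dvd (by omega) h3
  omega

/-- The contribution of the nontrivial `a`-th roots of unity to the number of representations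
of `t` by `a, b, c`. -/
noncomputable def rootContribution (a b c : ℕ) (t : ℤ) : ℂ :=
  -((1 / (4 * (a : ℂ))) * ∑ k ∈ Finset.Icc 1 (a - 1),
      Complex.exp (Real.pi * Complex.I * k / a * (2 * t + b + c)) /
        ((Real.sin (Real.pi * k * b / a) : ℂ) * (Real.sin (Real.pi * k * c / a) : ℂ)))

theorem periodicPart_eq_neg_add (a b c : ℕ) (t : ℤ) :
    periodicPart a b c t =
      -(rootContribution a b c t + rootContribution b a c t + rootContribution c a b t) := by
  simp only [periodicPart, rootContribution]
  ring

theorem rootContribution_add_self {a : ℕ} (b c : ℕ) (ha : a ≠ 0) (t : ℤ) :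
    rootContribution a b c (t + a) = rootContribution a b c t := by
  unfold rootContribution
  congr 2
  refine Finset.sum_congr rfl fun k _ => ?_
  congr 1
  have ha' : (a : ℂ) ≠ 0 := by exact_mod_cast ha
  have h : Real.pi * Complex.I * k / a * (2 * ((t + a : ℤ) : ℂ) + b + c) =
      Real.pi * Complex.I * k / a * (2 * t + b + c) + (k : ℤ) * (2 * Real.pi * Complex.I) := by
    push_cast
    field_simp
    ring
  rw [h, Complex.exp_add, Complex.exp_int_mul_two_pi_mul_I, mul_one]

theorem sum_range_rootContribution {a : ℕ} (b c : ℕ) (ha : a ≠ 0) :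
    ∑ t ∈ Finset.range a, rootContribution a b c t = 0 := by
  unfold rootContribution
  rw [Finset.sum_neg_distrib, ← Finset.mul_sum, Finset.sum_comm, neg_eq_zero]
  refine mul_eq_zero_of_right _ (Finset.sum_eq_zero fun k hk => ?_)
  rw [Finset.mem_Icc] at hk
  rw [← Finset.sum_div, div_eq_zero_iff]
  left
  have h : ∀ t : ℕ, Complex.exp (Real.pi * Complex.I * k / a * (2 * ((t : ℤ) : ℂ) + b + c)) =
      Complex.exp (2 * Real.pi * Complex.I * t * (k : ℤ) / a) *
        Complex.exp (Real.pi * Complex.I * k / a * (b + c)) := fun t => by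
    rw [← Complex.exp_add]
    congr 1
    push_cast
    ring
  simp_rw [h]
  rw [← Finset.sum_mul, sum_range_cexp_two_pi_mul_div ha, if_neg, zero_mul]
  intro hd
  have := Nat.le_of_dvd (by omega) (by exact_mod_cast hd : a ∣ k)
  omega

theorem rootContribution_second_difference {a b c : ℕ} (ha : a ≠ 0) (hab : Nat.Coprime a b)
    (hac : Nat.Coprime a c) (t : ℤ) :
    rootContribution a b c t - rootContribution a b c (t - b) - rootContribution a b c (t - c) +
      rootContribution a b c (t - b - c) = (if (a : ℤ) ∣ t then 1 else 0) - 1 / a := by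
  have ha' : (a : ℂ) ≠ 0 := by exact_mod_cast ha
  have hsum := sum_range_cexp_two_pi_mul_div ha t
  have hrange : ∑ k ∈ Finset.range a, Complex.exp (2 * Real.pi * Complex.I * k * t / a) =
      1 + ∑ k ∈ Finset.Icc 1 (a - 1), Complex.exp (2 * Real.pi * Complex.I * k * t / a) := by
    obtain ⟨n, rfl⟩ := Nat.exists_eq_succ_of_ne_zero ha
    rw [Finset.range_eq_Ico, Finset.sum_eq_sum_Ico_succ_bot (Nat.succ_pos n)]
    simp only [Nat.succ_eq_add_one, zero_add, Nat.add_sub_cancel]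
    congr 1
    simp
  have hterm : ∑ k ∈ Finset.Icc 1 (a - 1), Complex.exp (2 * Real.pi * Complex.I * k * t / a) =
      (-1 / 4) * ∑ k ∈ Finset.Icc 1 (a - 1),
        ((Complex.exp (Real.pi * Complex.I * k / a * (2 * t + b + c)) -
          Complex.exp (Real.pi * Complex.I * k / a * (2 * ((t - b : ℤ) : ℂ) + b + c)) -
          Complex.exp (Real.pi * Complex.I * k / a * (2 * ((t - c : ℤ) : ℂ) + b + c)) +
          Complex.exp (Real.pi * Complex.I * k / a * (2 * ((t - b - c : ℤ) : ℂ) + b + c))) /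
        ((Real.sin (Real.pi * k * b / a) : ℂ) * (Real.sin (Real.pi * k * c / a) : ℂ))) := by
    rw [Finset.mul_sum]
    refine Finset.sum_congr rfl fun k hk => ?_
    have hsb : (Real.sin (Real.pi * k * b / a) : ℂ) ≠ 0 := by
      exact_mod_cast sin_pi_mul_div_ne_zero hab hk
    have hsc : (Real.sin (Real.pi * k * c / a) : ℂ) ≠ 0 := by
      exact_mod_cast sin_pi_mul_div_ne_zero hac hk
    rw [← mul_div_assoc, eq_div_iff (mul_ne_zero hsb hsc)]
    set y : ℂ := 2 * Real.pi * Complex.I * k * t / a with hy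
    set u : ℂ := ((Real.pi * k * b / a : ℝ) : ℂ) with hu
    set v : ℂ := ((Real.pi * k * c / a : ℝ) : ℂ) with hv
    rw [Complex.ofReal_sin, Complex.ofReal_sin, ← hu, ← hv]
    have e1 : Real.pi * Complex.I * k / a * (2 * t + b + c) =
        y + u * Complex.I + v * Complex.I := by
      rw [hy, hu, hv]; push_cast; ring
    have e2 : Real.pi * Complex.I * k / a * (2 * ((t - b : ℤ) : ℂ) + b + c) =
        y + -u * Complex.I + v * Complex.I := by
      rw [hy, hu, hv]; push_cast; ring
    have e3 : Real.pi * Complex.I * k / a * (2 * ((t - c : ℤ) : ℂ) + b + c) =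
        y + u * Complex.I + -v * Complex.I := by
      rw [hy, hu, hv]; push_cast; ring
    have e4 : Real.pi * Complex.I * k / a * (2 * ((t - b - c : ℤ) : ℂ) + b + c) =
        y + -u * Complex.I + -v * Complex.I := by
      rw [hy, hu, hv]; push_cast; ring
    rw [e1, e2, e3, e4]
    simp only [Complex.exp_add, Complex.sin]
    linear_combination (Complex.exp y * (Complex.exp (-u * Complex.I) - Complex.exp (u * Complex.I))
      * (Complex.exp (-v * Complex.I) - Complex.exp (v * Complex.I)) / 4) * Complex.I_sq
  have hdiff : rootContribution a b c t - rootContribution a b c (t - b) -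
      rootContribution a b c (t - c) + rootContribution a b c (t - b - c) =
      (1 / a) * ∑ k ∈ Finset.Icc 1 (a - 1),
        Complex.exp (2 * Real.pi * Complex.I * k * t / a) := by
    rw [hterm]
    simp only [rootContribution, add_div, sub_div, Finset.sum_add_distrib, Finset.sum_sub_distrib]
    ring
  rw [hdiff, eq_sub_of_add_eq' (hrange.symm.trans hsum)]
  split_ifs <;> field_simp
  ring

end Trigonometric

section PolynomialPart

open Polynomial

/-- The `a`-th partial sum of the generating function of `f`. -/
noncomputable def truncatedGenFun (a : ℕ) (f : ℤ → ℂ) : ℂ[X] :=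
  ∑ t ∈ Finset.range a, C (f t) * X ^ t

theorem X_pow_sub_one_dvd_X_mul_truncatedGenFun_sub (a : ℕ) {f : ℤ → ℂ}
    (hf : ∀ t, f (t + a) = f t) :
    (X ^ a - 1 : ℂ[X]) ∣
      X * truncatedGenFun a f - truncatedGenFun a (fun t => f (t - 1)) := by
  refine ⟨C (f (-1)), ?_⟩
  have h1 := Finset.sum_range_succ (fun t : ℕ => C (f ((t : ℤ) - 1)) * X ^ t) a
  rw [Finset.sum_range_succ'] at h1
  have h2 : f ((a : ℤ) - 1) = f (-1) := by
    rw [← hf (-1), neg_add_eq_sub]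
  simp only [Nat.cast_add, Nat.cast_one, add_sub_cancel_right, Nat.cast_zero, zero_sub, pow_zero,
    h2] at h1
  have h3 : X * truncatedGenFun a f = ∑ t ∈ Finset.range a, C (f t) * X ^ (t + 1) := by
    rw [truncatedGenFun, Finset.mul_sum]
    exact Finset.sum_congr rfl fun t _ => by ring
  rw [h3, truncatedGenFun]
  linear_combination h1

theorem X_pow_sub_one_dvd_X_pow_mul_truncatedGenFun_sub (a m : ℕ) {f : ℤ → ℂ}
    (hf : ∀ t, f (t + a) = f t) :
    (X ^ a - 1 : ℂ[X]) ∣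
      X ^ m * truncatedGenFun a f - truncatedGenFun a (fun t => f (t - m)) := by
  induction m with
  | zero => simp
  | succ m ih =>
    have h := X_pow_sub_one_dvd_X_mul_truncatedGenFun_sub a (f := fun t => f (t - m))
      (fun t => by rw [← hf (t - m)]; congr 1; ring)
    have h' := (ih.mul_left X).add h
    have e : (fun t : ℤ => f (t - 1 - (m : ℤ))) = fun t => f (t - ((m + 1 : ℕ) : ℤ)) := by
      funext t
      congr 1
      push_cast
      ring
    simp only [e] at h'
    convert h' using 1
    ring

theorem truncatedGenFun_add (a : ℕ) (f g : ℤ → ℂ) :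
    truncatedGenFun a (fun t => f t + g t) = truncatedGenFun a f + truncatedGenFun a g := by
  simp [truncatedGenFun, add_mul, Finset.sum_add_distrib]

theorem truncatedGenFun_sub (a : ℕ) (f g : ℤ → ℂ) :
    truncatedGenFun a (fun t => f t - g t) = truncatedGenFun a f - truncatedGenFun a g := by
  simp [truncatedGenFun, sub_mul, Finset.sum_sub_distrib]

theorem truncatedGenFun_dvd_sub (a : ℕ) (ha : a ≠ 0) :
    truncatedGenFun a (fun t => (if (a : ℤ) ∣ t then 1 else 0) - 1 / a) =
      1 - C (1 / (a : ℂ)) * ∑ i ∈ Finset.range a, X ^ i := by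
  rw [truncatedGenFun_sub]
  congr 1
  · rw [truncatedGenFun, Finset.sum_eq_single 0]
    · simp
    · intro t ht h0
      rw [if_neg]
      · simp
      · intro h
        have := Nat.le_of_dvd (by omega) (by exact_mod_cast h : a ∣ t)
        rw [Finset.mem_range] at ht
        omega
    · intro h
      simp at h
      omega
  · rw [truncatedGenFun, Finset.mul_sum]

theorem geom_sum_dvd_mul_truncatedGenFun_sub_one {a b c : ℕ} (ha : a ≠ 0) {f : ℤ → ℂ}
    (hf : ∀ t, f (t + a) = f t)
    (hd : ∀ t, f t - f (t - b) - f (t - c) + f (t - b - c) =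
      (if (a : ℤ) ∣ t then 1 else 0) - 1 / a) :
    (∑ i ∈ Finset.range a, X ^ i : ℂ[X]) ∣
      (1 - X ^ b) * (1 - X ^ c) * truncatedGenFun a f - 1 := by
  have hgeom : (∑ i ∈ Finset.range a, X ^ i : ℂ[X]) ∣ X ^ a - 1 :=
    ⟨X - 1, (geom_sum_mul X a).symm⟩
  have hb := hgeom.trans (X_pow_sub_one_dvd_X_pow_mul_truncatedGenFun_sub a b hf)
  have hc := hgeom.trans (X_pow_sub_one_dvd_X_pow_mul_truncatedGenFun_sub a c hf)
  have hbc := hgeom.trans (X_pow_sub_one_dvd_X_pow_mul_truncatedGenFun_sub a (b + c) hf)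
  have key : truncatedGenFun a f - truncatedGenFun a (fun t => f (t - b)) -
      truncatedGenFun a (fun t => f (t - c)) +
      truncatedGenFun a (fun t => f (t - (b + c : ℕ))) =
      1 - C (1 / (a : ℂ)) * ∑ i ∈ Finset.range a, X ^ i := by
    rw [← truncatedGenFun_dvd_sub a ha, ← truncatedGenFun_sub, ← truncatedGenFun_sub,
      ← truncatedGenFun_add]
    congr 1
    funext t
    rw [← hd t]
    congr 2
    push_cast
    ring
  have h := ((hbc.sub hb).sub hc).sub
    (Dvd.intro_left (C (1 / (a : ℂ))) (rfl : _ = _ * ∑ i ∈ Finset.range a, (X : ℂ[X]) ^ i))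
  convert h using 1
  linear_combination key

theorem X_sub_one_dvd_truncatedGenFun {a : ℕ} {f : ℤ → ℂ}
    (hs : ∑ t ∈ Finset.range a, f t = 0) : (X - 1 : ℂ[X]) ∣ truncatedGenFun a f := by
  rw [← C_1, dvd_iff_isRoot, IsRoot, truncatedGenFun, eval_finsetSum]
  simpa using hs

theorem degree_truncatedGenFun_lt (a : ℕ) (f : ℤ → ℂ) :
    (truncatedGenFun a f).degree < a := by
  rw [← mem_degreeLT]
  refine Submodule.sum_mem _ fun t ht => mem_degreeLT.2 ?_
  exact (degree_C_mul_X_pow_le _ _).trans_lt (by simpa using ht)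

theorem isCoprime_geom_sum {a b : ℕ} (ha : a ≠ 0) (hab : Nat.Coprime a b) :
    IsCoprime (∑ i ∈ Finset.range a, X ^ i : ℂ[X]) (∑ i ∈ Finset.range b, X ^ i) := by
  rw [isCoprime_iff_aeval_ne_zero_of_isAlgClosed ℂ ℂ]
  intro z
  by_contra! h
  simp only [map_sum, map_pow, aeval_X] at h
  have h1 : z ^ a = 1 := by
    rw [← sub_eq_zero, ← geom_sum_mul, h.1, zero_mul]
  have h2 : z ^ b = 1 := by
    rw [← sub_eq_zero, ← geom_sum_mul, h.2, zero_mul]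
  have h3 : z = 1 := by
    have := pow_gcd_eq_one.2 ⟨h1, h2⟩
    rwa [hab.gcd_eq_one, pow_one] at this
  rw [h3] at h
  simp [ha] at h

theorem isCoprime_X_sub_one_geom_sum {a : ℕ} (ha : a ≠ 0) :
    IsCoprime (X - 1 : ℂ[X]) (∑ i ∈ Finset.range a, X ^ i) := by
  rw [isCoprime_iff_aeval_ne_zero_of_isAlgClosed ℂ ℂ]
  intro z
  by_contra! h
  simp only [map_sum, map_pow, aeval_X, map_sub, map_one, sub_eq_zero] at h
  rw [h.1] at h
  simp [ha] at h

theorem exists_X_pow_eq_add_cube (n : ℕ) : ∃ h : ℂ[X],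
    X ^ n = 1 + C (n : ℂ) * (X - 1) + C ((n : ℂ) * (n - 1) / 2) * (X - 1) ^ 2 +
      (X - 1) ^ 3 * h := by
  induction n with
  | zero => exact ⟨0, by simp⟩
  | succ n ih =>
    obtain ⟨h, hh⟩ := ih
    refine ⟨C ((n : ℂ) * (n - 1) / 2) + X * h, ?_⟩
    have e : C (((n + 1 : ℕ) : ℂ) * ((n + 1 : ℕ) - 1) / 2) =
        C ((n : ℂ) * (n - 1) / 2) + C (n : ℂ) := by
      rw [← C_add]
      congr 1
      push_cast
      ring
    rw [e, pow_succ, hh]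
    push_cast
    simp only [C_add, C_1]
    ring

theorem exists_geom_sum_eq_add_cube (n : ℕ) : ∃ h : ℂ[X],
    ∑ i ∈ Finset.range n, X ^ i = C (n : ℂ) + C ((n : ℂ) * (n - 1) / 2) * (X - 1) +
      C ((n : ℂ) * (n - 1) * (n - 2) / 6) * (X - 1) ^ 2 + (X - 1) ^ 3 * h := by
  induction n with
  | zero => exact ⟨0, by simp⟩
  | succ n ih =>
    obtain ⟨h, hh⟩ := ih
    obtain ⟨h', hh'⟩ := exists_X_pow_eq_add_cube n
    refine ⟨h + h', ?_⟩
    have e1 : C (((n + 1 : ℕ) : ℂ) * ((n + 1 : ℕ) - 1) / 2) =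
        C ((n : ℂ) * (n - 1) / 2) + C (n : ℂ) := by
      rw [← C_add]
      congr 1
      push_cast
      ring
    have e2 : C (((n + 1 : ℕ) : ℂ) * ((n + 1 : ℕ) - 1) * ((n + 1 : ℕ) - 2) / 6) =
        C ((n : ℂ) * (n - 1) * (n - 2) / 6) + C ((n : ℂ) * (n - 1) / 2) := by
      rw [← C_add]
      congr 1
      push_cast
      ring
    rw [Finset.sum_range_succ, hh, hh', e1, e2]
    push_cast
    simp only [C_add, C_1]
    ring

/-- The polynomial part of the number of representations of `t` by `a, b, c`. -/
noncomputable def polynomialPart (a b c : ℕ) (t : ℂ) : ℂ :=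
  ((t + ((a : ℂ) + b + c) / 2) ^ 2 - ((a : ℂ) ^ 2 + b ^ 2 + c ^ 2) / 12) / (2 * (a * b * c))

/-- The numerator over `(1 - X) ^ 3` of the generating function of `polynomialPart a b c`. -/
noncomputable def polynomialPartNumerator (a b c : ℕ) : ℂ[X] :=
  C (1 / ((a : ℂ) * b * c)) - C (((a : ℂ) + b + c - 3) / (2 * (a * b * c))) * (X - 1) +
    C (polynomialPart a b c 0 - 1 / ((a : ℂ) * b * c) -
      ((a : ℂ) + b + c - 3) / (2 * (a * b * c))) * (X - 1) ^ 2

theorem X_sub_one_pow_three_dvd {a b c : ℕ} (ha : a ≠ 0) (hb : b ≠ 0) (hc : c ≠ 0) :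
    (X - 1 : ℂ[X]) ^ 3 ∣ polynomialPartNumerator a b c * (∑ i ∈ Finset.range a, X ^ i) *
      (∑ i ∈ Finset.range b, X ^ i) * (∑ i ∈ Finset.range c, X ^ i) - 1 := by
  have ha' : (a : ℂ) ≠ 0 := by exact_mod_cast ha
  have hb' : (b : ℂ) ≠ 0 := by exact_mod_cast hb
  have hc' : (c : ℂ) ≠ 0 := by exact_mod_cast hc
  obtain ⟨h₁, e₁⟩ := exists_geom_sum_eq_add_cube a
  obtain ⟨h₂, e₂⟩ := exists_geom_sum_eq_add_cube b
  obtain ⟨h₃, e₃⟩ := exists_geom_sum_eq_add_cube c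
  have mulMod : ∀ (p₀ p₁ p₂ q₀ q₁ q₂ : ℂ) (h k : ℂ[X]), ∃ l : ℂ[X],
      (C p₀ + C p₁ * (X - 1) + C p₂ * (X - 1) ^ 2 + (X - 1) ^ 3 * h) *
      (C q₀ + C q₁ * (X - 1) + C q₂ * (X - 1) ^ 2 + (X - 1) ^ 3 * k) =
      C (p₀ * q₀) + C (p₀ * q₁ + p₁ * q₀) * (X - 1) +
        C (p₀ * q₂ + p₁ * q₁ + p₂ * q₀) * (X - 1) ^ 2 + (X - 1) ^ 3 * l := by
    intro p₀ p₁ p₂ q₀ q₁ q₂ h k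
    refine ⟨h * (C q₀ + C q₁ * (X - 1) + C q₂ * (X - 1) ^ 2 + (X - 1) ^ 3 * k) +
      (C p₀ + C p₁ * (X - 1) + C p₂ * (X - 1) ^ 2) * k +
      C p₁ * C q₂ + C p₂ * C q₁ + C p₂ * C q₂ * (X - 1), ?_⟩
    simp only [C_add, C_mul]
    ring
  have e₀ : polynomialPartNumerator a b c = C (1 / ((a : ℂ) * b * c)) +
      C (-(((a : ℂ) + b + c - 3) / (2 * (a * b * c)))) * (X - 1) +
      C (polynomialPart a b c 0 - 1 / ((a : ℂ) * b * c) -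
        ((a : ℂ) + b + c - 3) / (2 * (a * b * c))) * (X - 1) ^ 2 + (X - 1) ^ 3 * 0 := by
    rw [polynomialPartNumerator, C_neg]
    ring
  rw [e₀, e₁, e₂, e₃]
  obtain ⟨l₁, f₁⟩ := mulMod _ _ _ _ _ _ _ _
  rw [f₁]
  obtain ⟨l₂, f₂⟩ := mulMod _ _ _ _ _ _ _ _
  rw [f₂]
  obtain ⟨l₃, f₃⟩ := mulMod _ _ _ _ _ _ _ _
  rw [f₃]
  refine ⟨l₃, ?_⟩
  rw [sub_eq_iff_eq_add', add_left_inj, add_assoc, ← C_1]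
  have z0 : ∀ p₀ p₁ p₂ : ℂ, p₀ = 1 → p₁ = 0 → p₂ = 0 →
      C p₀ + (C p₁ * (X - C 1) + C p₂ * (X - C 1) ^ 2) = C 1 := by
    rintro _ _ _ rfl rfl rfl
    simp
  apply z0
  · field_simp
  · field_simp
    ring
  · simp only [polynomialPart]
    field_simp
    ring

theorem natDegree_polynomialPartNumerator_le (a b c : ℕ) :
    (polynomialPartNumerator a b c).natDegree ≤ 2 := by
  unfold polynomialPartNumerator
  rw [← C_1]
  compute_degree

end PolynomialPart

section GeneratingFunction

open PowerSeries

theorem one_sub_X_pow_mul_mk_of_periodic (a : ℕ) {f : ℤ → ℂ} (hf : ∀ t, f (t + a) = f t) :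
    (1 - X ^ a : ℂ⟦X⟧) * PowerSeries.mk (fun n : ℕ => f n) = (truncatedGenFun a f : Polynomial ℂ) := by
  ext n
  have hcoe : coeff n ((truncatedGenFun a f : Polynomial ℂ) : ℂ⟦X⟧) =
      if n < a then f n else 0 := by
    rw [Polynomial.coeff_coe, truncatedGenFun, Polynomial.finsetSum_coeff]
    simp [Polynomial.coeff_X_pow]
  rw [hcoe, sub_mul, one_mul, map_sub, coeff_X_pow_mul']
  simp only [coeff_mk]
  split_ifs with h1 h2 h2
  · omega
  · rw [← hf ((n - a : ℕ) : ℤ), Nat.cast_sub h1, sub_add_cancel, sub_self]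
  · rw [sub_zero]
  · omega

theorem one_sub_X_mul_mk (f : ℤ → ℂ) (g : ℤ → ℂ) (h0 : f 0 = g 0)
    (h : ∀ t, f (t + 1) - f t = g (t + 1)) :
    (1 - X : ℂ⟦X⟧) * PowerSeries.mk (fun n : ℕ => f n) = PowerSeries.mk (fun n : ℕ => g n) := by
  ext n
  rw [sub_mul, one_mul, map_sub]
  cases n with
  | zero => simpa using h0
  | succ n =>
    rw [coeff_succ_X_mul]
    simpa using h n

theorem one_sub_X_pow_three_mul_mk_polynomialPart {a b c : ℕ} (ha : a ≠ 0) (hb : b ≠ 0)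
    (hc : c ≠ 0) :
    (1 - X : ℂ⟦X⟧) ^ 3 * PowerSeries.mk (fun n : ℕ => polynomialPart a b c n) =
      (polynomialPartNumerator a b c : Polynomial ℂ) := by
  have ha' : (a : ℂ) ≠ 0 := by exact_mod_cast ha
  have hb' : (b : ℂ) ≠ 0 := by exact_mod_cast hb
  have hc' : (c : ℂ) ≠ 0 := by exact_mod_cast hc
  have hone : (1 - X : ℂ⟦X⟧) * PowerSeries.mk 1 = 1 := by
    rw [mul_comm]
    exact mk_one_mul_one_sub_eq_one ℂ
  have htwo : (1 - X : ℂ⟦X⟧) * PowerSeries.mk (fun n : ℕ => (n : ℂ) + 1) = PowerSeries.mk 1 := by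
    refine Eq.trans ?_ (one_sub_X_mul_mk (fun t => (t : ℂ) + 1) (fun _ => 1) (by simp)
      (fun t => by push_cast; ring))
    simp
  have hthree : (1 - X : ℂ⟦X⟧) * PowerSeries.mk (fun n : ℕ => ((n : ℂ) + 1) * (n + 2) / 2) =
      PowerSeries.mk (fun n : ℕ => (n : ℂ) + 1) := by
    simpa using one_sub_X_mul_mk (fun t => ((t : ℂ) + 1) * (t + 2) / 2) (fun t => (t : ℂ) + 1)
      (by norm_num) (fun t => by push_cast; ring)
  have hmk : PowerSeries.mk (fun n : ℕ => polynomialPart a b c n) =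
      C (1 / ((a : ℂ) * b * c)) * PowerSeries.mk (fun n : ℕ => ((n : ℂ) + 1) * (n + 2) / 2) +
      C (((a : ℂ) + b + c - 3) / (2 * (a * b * c))) * PowerSeries.mk (fun n : ℕ => (n : ℂ) + 1) +
      C (polynomialPart a b c 0 - 1 / ((a : ℂ) * b * c) -
        ((a : ℂ) + b + c - 3) / (2 * (a * b * c))) * PowerSeries.mk 1 := by
    ext n
    simp only [map_add, coeff_C_mul, coeff_mk, Pi.one_apply, polynomialPart]
    field_simp
    ring
  rw [hmk, polynomialPartNumerator]
  simp only [Polynomial.coe_add, Polynomial.coe_sub, Polynomial.coe_mul, Polynomial.coe_pow,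
    Polynomial.coe_C, Polynomial.coe_X, Polynomial.coe_one]
  set p := C (1 / ((a : ℂ) * b * c))
  set q := C (((a : ℂ) + b + c - 3) / (2 * (a * b * c)))
  set r := C (polynomialPart a b c 0 - 1 / ((a : ℂ) * b * c) -
    ((a : ℂ) + b + c - 3) / (2 * (a * b * c)))
  linear_combination p * (1 - X) ^ 2 * hthree +
    (p * (1 - X) + q * (1 - X) ^ 2) * htwo + (p + q * (1 - X) + r * (1 - X) ^ 2) * hone

theorem natDegree_geom_sum_X_add_one {n : ℕ} (hn : n ≠ 0) :
    (∑ i ∈ Finset.range n, Polynomial.X ^ i : Polynomial ℂ).natDegree + 1 = n := by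
  have h := congrArg Polynomial.natDegree (geom_sum_mul (Polynomial.X : Polynomial ℂ) n)
  rw [← Polynomial.C_1, (Polynomial.monic_geom_sum_X hn).natDegree_mul
    (Polynomial.monic_X_sub_C 1), Polynomial.natDegree_X_sub_C,
    Polynomial.natDegree_X_pow_sub_C] at h
  exact h

theorem degree_one_sub_X_pow_mul_mul_lt {p : Polynomial ℂ} {k m n : ℕ} (hp : p.degree < k) :
    ((1 - Polynomial.X ^ m) * (1 - Polynomial.X ^ n) * p).degree < ((m + n + k : ℕ) : WithBot ℕ) := by
  have h : ∀ n : ℕ, (1 - Polynomial.X ^ n : Polynomial ℂ).degree ≤ n := fun n => by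
    rw [← Polynomial.C_1]
    compute_degree
    exact le_rfl
  rcases eq_or_ne p 0 with rfl | h0
  · simp
  · have hp' := (Polynomial.natDegree_lt_iff_degree_lt h0).2 hp
    have hle : ((1 - Polynomial.X ^ m) * (1 - Polynomial.X ^ n) * p).degree ≤
        ((m + n + p.natDegree : ℕ) : WithBot ℕ) := by
      push_cast
      exact Polynomial.degree_mul_le_of_le (Polynomial.degree_mul_le_of_le (h m) (h n))
        Polynomial.degree_le_natDegree
    exact hle.trans_lt (by exact_mod_cast (by omega : m + n + p.natDegree < m + n + k))

/-- The polynomial form of the partial fraction decomposition of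
`1 / ((1 - X ^ a) * (1 - X ^ b) * (1 - X ^ c))`. -/
theorem partialFraction_rootContribution {a b c : ℕ} (ha : a ≠ 0) (hb : b ≠ 0) (hc : c ≠ 0)
    (hab : Nat.Coprime a b) (hac : Nat.Coprime a c) (hbc : Nat.Coprime b c) :
    polynomialPartNumerator a b c * (∑ i ∈ Finset.range a, Polynomial.X ^ i) *
      (∑ i ∈ Finset.range b, Polynomial.X ^ i) * (∑ i ∈ Finset.range c, Polynomial.X ^ i) +
      (1 - Polynomial.X ^ b) * (1 - Polynomial.X ^ c) *
        truncatedGenFun a (rootContribution a b c) +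
      (1 - Polynomial.X ^ a) * (1 - Polynomial.X ^ c) *
        truncatedGenFun b (rootContribution b a c) +
      (1 - Polynomial.X ^ a) * (1 - Polynomial.X ^ b) *
        truncatedGenFun c (rootContribution c a b) = 1 := by
  have hA := geom_sum_dvd_mul_truncatedGenFun_sub_one ha (rootContribution_add_self b c ha)
    (rootContribution_second_difference ha hab hac)
  have hB := geom_sum_dvd_mul_truncatedGenFun_sub_one hb (rootContribution_add_self a c hb)
    (rootContribution_second_difference hb hab.symm hbc)
  have hC := geom_sum_dvd_mul_truncatedGenFun_sub_one hc (rootContribution_add_self a b hc)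
    (rootContribution_second_difference hc hac.symm hbc.symm)
  have hA1 := X_sub_one_dvd_truncatedGenFun (sum_range_rootContribution b c ha)
  have hB1 := X_sub_one_dvd_truncatedGenFun (sum_range_rootContribution a c hb)
  have hC1 := X_sub_one_dvd_truncatedGenFun (sum_range_rootContribution a b hc)
  have hone := X_sub_one_pow_three_dvd ha hb hc
  have hga := mul_neg_geom_sum (Polynomial.X : Polynomial ℂ) a
  have hgb := mul_neg_geom_sum (Polynomial.X : Polynomial ℂ) b
  have hgc := mul_neg_geom_sum (Polynomial.X : Polynomial ℂ) c
  have cab := isCoprime_geom_sum ha hab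
  have cac := isCoprime_geom_sum ha hac
  have cbc := isCoprime_geom_sum hb hbc
  have ca1 := isCoprime_X_sub_one_geom_sum ha
  have cb1 := isCoprime_X_sub_one_geom_sum hb
  have cc1 := isCoprime_X_sub_one_geom_sum hc
  have dA := degree_truncatedGenFun_lt a (rootContribution a b c)
  have dB := degree_truncatedGenFun_lt b (rootContribution b a c)
  have dC := degree_truncatedGenFun_lt c (rootContribution c a b)
  have nA := natDegree_geom_sum_X_add_one ha
  have nB := natDegree_geom_sum_X_add_one hb
  have nC := natDegree_geom_sum_X_add_one hc
  have mA := Polynomial.monic_geom_sum_X (R := ℂ) ha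
  have mB := Polynomial.monic_geom_sum_X (R := ℂ) hb
  have mC := Polynomial.monic_geom_sum_X (R := ℂ) hc
  have nr := natDegree_polynomialPartNumerator_le a b c
  generalize truncatedGenFun a (rootContribution a b c) = E at *
  generalize truncatedGenFun b (rootContribution b a c) = F at *
  generalize truncatedGenFun c (rootContribution c a b) = G at *
  generalize polynomialPartNumerator a b c = r at *
  generalize (∑ i ∈ Finset.range a, Polynomial.X ^ i : Polynomial ℂ) = u at *
  generalize (∑ i ∈ Finset.range b, Polynomial.X ^ i : Polynomial ℂ) = v at *
  generalize (∑ i ∈ Finset.range c, Polynomial.X ^ i : Polynomial ℂ) = w at *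
  rw [← sub_eq_zero]
  have h1 : (Polynomial.X - 1) ^ 3 ∣ r * u * v * w +
      (1 - Polynomial.X ^ b) * (1 - Polynomial.X ^ c) * E +
      (1 - Polynomial.X ^ a) * (1 - Polynomial.X ^ c) * F +
      (1 - Polynomial.X ^ a) * (1 - Polynomial.X ^ b) * G - 1 := by
    rw [← hga, ← hgb, ← hgc]
    obtain ⟨E', rfl⟩ := hA1
    obtain ⟨F', rfl⟩ := hB1
    obtain ⟨G', rfl⟩ := hC1
    obtain ⟨s, hs⟩ := hone
    exact ⟨s + v * w * E' + u * w * F' + u * v * G', by linear_combination hs⟩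
  have hu : u ∣ r * u * v * w +
      (1 - Polynomial.X ^ b) * (1 - Polynomial.X ^ c) * E +
      (1 - Polynomial.X ^ a) * (1 - Polynomial.X ^ c) * F +
      (1 - Polynomial.X ^ a) * (1 - Polynomial.X ^ b) * G - 1 := by
    obtain ⟨s, hs⟩ := hA
    rw [← hga]
    exact ⟨s + r * v * w + (1 - Polynomial.X) * (1 - Polynomial.X ^ c) * F +
      (1 - Polynomial.X) * (1 - Polynomial.X ^ b) * G, by linear_combination hs⟩
  have hv : v ∣ r * u * v * w +
      (1 - Polynomial.X ^ b) * (1 - Polynomial.X ^ c) * E +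
      (1 - Polynomial.X ^ a) * (1 - Polynomial.X ^ c) * F +
      (1 - Polynomial.X ^ a) * (1 - Polynomial.X ^ b) * G - 1 := by
    obtain ⟨s, hs⟩ := hB
    rw [← hgb]
    exact ⟨s + r * u * w + (1 - Polynomial.X) * (1 - Polynomial.X ^ c) * E +
      (1 - Polynomial.X) * (1 - Polynomial.X ^ a) * G, by linear_combination hs⟩
  have hw : w ∣ r * u * v * w +
      (1 - Polynomial.X ^ b) * (1 - Polynomial.X ^ c) * E +
      (1 - Polynomial.X ^ a) * (1 - Polynomial.X ^ c) * F +
      (1 - Polynomial.X ^ a) * (1 - Polynomial.X ^ b) * G - 1 := by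
    obtain ⟨s, hs⟩ := hC
    rw [← hgc]
    exact ⟨s + r * u * v + (1 - Polynomial.X) * (1 - Polynomial.X ^ b) * E +
      (1 - Polynomial.X) * (1 - Polynomial.X ^ a) * F, by linear_combination hs⟩
  have hdvd : (Polynomial.X - 1) ^ 3 * u * v * w ∣ r * u * v * w +
      (1 - Polynomial.X ^ b) * (1 - Polynomial.X ^ c) * E +
      (1 - Polynomial.X ^ a) * (1 - Polynomial.X ^ c) * F +
      (1 - Polynomial.X ^ a) * (1 - Polynomial.X ^ b) * G - 1 :=
    ((cc1.pow_left.mul_left cac).mul_left cbc).mul_dvd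
      ((cb1.pow_left.mul_left cab).mul_dvd (ca1.pow_left.mul_dvd h1 hu) hv) hw
  have m1 : (Polynomial.X - 1 : Polynomial ℂ).Monic := Polynomial.monic_X_sub_C 1
  have hdeg : ((Polynomial.X - 1) ^ 3 * u * v * w).degree = ((a + b + c : ℕ) : WithBot ℕ) := by
    have m3 := m1.pow 3
    have hX : (Polynomial.X - 1 : Polynomial ℂ).natDegree = 1 := Polynomial.natDegree_X_sub_C 1
    rw [Polynomial.degree_eq_natDegree (((m3.mul mA).mul mB).mul mC).ne_zero,
      ((m3.mul mA).mul mB).natDegree_mul mC, (m3.mul mA).natDegree_mul mB,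
      m3.natDegree_mul mA, m1.natDegree_pow, hX]
    congr 1
    omega
  have hr : (r * u * v * w).degree < ((a + b + c : ℕ) : WithBot ℕ) := by
    have h := Polynomial.natDegree_mul_le_of_le (Polynomial.natDegree_mul_le_of_le
      (Polynomial.natDegree_mul_le_of_le nr (le_refl u.natDegree)) (le_refl v.natDegree))
      (le_refl w.natDegree)
    exact (Polynomial.degree_le_of_natDegree_le h).trans_lt (by
      exact_mod_cast (by omega : 2 + u.natDegree + v.natDegree + w.natDegree < a + b + c))
  have hE := degree_one_sub_X_pow_mul_mul_lt (m := b) (n := c) dA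
  have hF := degree_one_sub_X_pow_mul_mul_lt (m := a) (n := c) dB
  have hG := degree_one_sub_X_pow_mul_mul_lt (m := a) (n := b) dC
  rw [(by ring : b + c + a = a + b + c)] at hE
  rw [(by ring : a + c + b = a + b + c)] at hF
  have h0 : (1 : Polynomial ℂ).degree < ((a + b + c : ℕ) : WithBot ℕ) := by
    rw [Polynomial.degree_one]
    exact_mod_cast (by omega : 0 < a + b + c)
  refine Polynomial.eq_zero_of_dvd_of_degree_lt hdvd ?_
  rw [hdeg]
  rw [← Polynomial.mem_degreeLT] at *
  exact Submodule.sub_mem _ (Submodule.add_mem _ (Submodule.add_mem _ (Submodule.add_mem _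
    hr hE) hF) hG) h0

theorem coeff_prod_eq_zero_of_not_representable {a b c g : ℕ}
    (hg : ¬ ∃ x y z : ℕ, g = x * a + y * b + z * c) :
    coeff g ((PowerSeries.mk (fun n : ℕ => if a ∣ n then (1 : ℂ) else 0)) *
      (PowerSeries.mk (fun n : ℕ => if b ∣ n then (1 : ℂ) else 0)) *
      (PowerSeries.mk (fun n : ℕ => if c ∣ n then (1 : ℂ) else 0))) = 0 := by
  rw [coeff_mul]
  refine Finset.sum_eq_zero fun p hp => ?_
  rw [coeff_mul, Finset.sum_mul]
  refine Finset.sum_eq_zero fun q hq => ?_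
  rw [Finset.HasAntidiagonal.mem_antidiagonal] at hp hq
  simp only [coeff_mk]
  split_ifs with h1 h2 h3 <;> try simp
  obtain ⟨x, hx⟩ := h1
  obtain ⟨y, hy⟩ := h2
  obtain ⟨z, hz⟩ := h3
  exact hg ⟨x, y, z, by rw [← hp, ← hq, hx, hy, hz]; ring⟩

theorem one_sub_X_pow_mul_mk_dvd {a : ℕ} (ha : a ≠ 0) :
    (1 - X ^ a : ℂ⟦X⟧) * PowerSeries.mk (fun n : ℕ => if a ∣ n then (1 : ℂ) else 0) = 1 := by
  ext n
  rw [sub_mul, one_mul, map_sub, coeff_X_pow_mul', coeff_one]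
  simp only [coeff_mk]
  rcases Nat.lt_or_ge n a with h | h
  · rw [if_neg (by omega : ¬ a ≤ n), sub_zero]
    refine if_congr ⟨fun hd => Nat.eq_zero_of_dvd_of_lt hd h, ?_⟩ rfl rfl
    rintro rfl
    exact dvd_zero a
  · rw [if_pos h, if_neg (by omega : ¬ n = 0)]
    simp only [Nat.dvd_sub_iff_left h dvd_rfl, sub_self]

/-- If `g` is not representable then the Beck-Robins formula for the number of representations
of `g` vanishes. -/
theorem polynomialPart_eq_periodicPart_of_not_representable {a b c g : ℕ} (ha : a ≠ 0)
    (hb : b ≠ 0) (hc : c ≠ 0) (hab : Nat.Coprime a b) (hac : Nat.Coprime a c)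
    (hbc : Nat.Coprime b c) (hg : ¬ ∃ x y z : ℕ, g = x * a + y * b + z * c) :
    polynomialPart a b c g = periodicPart a b c g := by
  have hP := one_sub_X_pow_three_mul_mk_polynomialPart ha hb hc
  have hA := one_sub_X_pow_mul_mk_of_periodic a (rootContribution_add_self b c ha)
  have hB := one_sub_X_pow_mul_mk_of_periodic b (rootContribution_add_self a c hb)
  have hC := one_sub_X_pow_mul_mk_of_periodic c (rootContribution_add_self a b hc)
  have hdec := congrArg (fun p : Polynomial ℂ => (p : ℂ⟦X⟧))
    (partialFraction_rootContribution ha hb hc hab hac hbc)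
  have hgeom : ∀ n : ℕ, (1 - X : ℂ⟦X⟧) *
      ((∑ i ∈ Finset.range n, Polynomial.X ^ i : Polynomial ℂ) : ℂ⟦X⟧) = 1 - X ^ n := fun n => by
    simpa using congrArg (fun p : Polynomial ℂ => (p : ℂ⟦X⟧)) (mul_neg_geom_sum Polynomial.X n)
  have ga := hgeom a
  have gb := hgeom b
  have gc := hgeom c
  have ia := one_sub_X_pow_mul_mk_dvd ha
  have ib := one_sub_X_pow_mul_mk_dvd hb
  have ic := one_sub_X_pow_mul_mk_dvd hc
  have hcoeff := coeff_prod_eq_zero_of_not_representable hg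
  simp only [Polynomial.coe_add, Polynomial.coe_sub, Polynomial.coe_mul, Polynomial.coe_pow,
    Polynomial.coe_X, Polynomial.coe_one] at hdec
  rw [← hP, ← hA, ← hB, ← hC] at hdec
  have hprod : (1 - X ^ a : ℂ⟦X⟧) * (1 - X ^ b) * (1 - X ^ c) *
      (PowerSeries.mk (fun n : ℕ => polynomialPart a b c n) + PowerSeries.mk (fun n : ℕ => rootContribution a b c n) +
        PowerSeries.mk (fun n : ℕ => rootContribution b a c n) +
        PowerSeries.mk (fun n : ℕ => rootContribution c a b n)) = 1 := by
    refine Eq.trans ?_ hdec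
    rw [← ga, ← gb, ← gc]
    ring
  have hinv : (1 - X ^ a : ℂ⟦X⟧) * (1 - X ^ b) * (1 - X ^ c) *
      ((PowerSeries.mk (fun n : ℕ => if a ∣ n then (1 : ℂ) else 0)) *
      (PowerSeries.mk (fun n : ℕ => if b ∣ n then (1 : ℂ) else 0)) *
      (PowerSeries.mk (fun n : ℕ => if c ∣ n then (1 : ℂ) else 0))) = 1 := by
    linear_combination (PowerSeries.mk (fun n : ℕ => if b ∣ n then (1 : ℂ) else 0)) * (1 - X ^ b) *
      ((PowerSeries.mk (fun n : ℕ => if c ∣ n then (1 : ℂ) else 0)) * (1 - X ^ c)) * ia +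
      ((PowerSeries.mk (fun n : ℕ => if c ∣ n then (1 : ℂ) else 0)) * (1 - X ^ c)) * ib + ic
  have heq := left_inv_eq_right_inv ((mul_comm _ _).trans hinv) hprod
  rw [heq] at hcoeff
  simp only [map_add, coeff_mk] at hcoeff
  rw [periodicPart_eq_neg_add]
  linear_combination hcoeff

end GeneratingFunction

/-- If the real part of the periodic part `P_t(a,b,c)` is bounded above by
`B ≥ 0` for every positive integer `t`, then
`g(a,b,c) ≤ √(2B·abc + (a²+b²+c²)/12) - (a+b+c)/2`. -/
theorem frobenius_le_of_periodicPart_bound (a b c : ℕ)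
    (ha : 2 ≤ a) (hb : 2 ≤ b) (hc : 2 ≤ c)
    (hab : Nat.Coprime a b) (hac : Nat.Coprime a c) (hbc : Nat.Coprime b c)
    (B : ℝ) (hB : 0 ≤ B)
    (hbound : ∀ t : ℕ, 0 < t → (periodicPart a b c t).re ≤ B)
    (g : ℕ)
    (hg : IsGreatest {t : ℕ | ¬ ∃ x y z : ℕ, t = x * a + y * b + z * c} g) :
    (g : ℝ) ≤ Real.sqrt (2 * B * (a * b * c) + ((a : ℝ) ^ 2 + b ^ 2 + c ^ 2) / 12) -
      ((a : ℝ) + b + c) / 2 := by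
  have hg0 : 0 < g := by
    rcases Nat.eq_zero_or_pos g with h | h
    · exact absurd ⟨0, 0, 0, by simp [h]⟩ hg.1
    · exact h
  have hre := congrArg Complex.re (polynomialPart_eq_periodicPart_of_not_representable
    (by omega) (by omega) (by omega) hab hac hbc hg.1)
  have hcast : polynomialPart a b c g = (((((g : ℝ) + ((a : ℝ) + b + c) / 2) ^ 2 -
      ((a : ℝ) ^ 2 + b ^ 2 + c ^ 2) / 12) / (2 * (a * b * c)) : ℝ) : ℂ) := by
    rw [polynomialPart]
    push_cast
    rfl
  rw [hcast, Complex.ofReal_re] at hre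
  have hle := hbound g hg0
  have hpos : (0 : ℝ) < 2 * (a * b * c) := by positivity
  rw [← hre, div_le_iff₀ hpos] at hle
  rw [le_sub_iff_add_le]
  exact Real.le_sqrt_of_sq_le (by linarith)
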